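/- There exist constants c, C > 0 such that for every integer t ≥ 1 and all integers n ≥ 2 and s ≥ 1 with s ≥ C · n^(1/t) · (t−1)!, it holds that λ(s,n) ≥ c · n² · s / (t−1)!. -/

import Mathlib

/-- The alternating sequence `a, b, a, b, ...` of length `k`. -/
def altSeq {α : Type*} (a b : α) : ℕ → List α
  | 0 => []
  | k + 1 => a :: altSeq b a k

/-- `l` avoids alternations of length `k`: it has no (not necessarily contiguous)
subsequence `a, b, a, b, ...` of length `k` with `a ≠ b`. -/
def AvoidsAlt {α : Type*} (l : List α) (k : ℕ) : Prop :=
  ∀ a b : α, a ≠ b → ¬ (altSeq a b k).Sublist l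

/-- `l` is an order-`s` Davenport–Schinzel sequence over an alphabet of `n` symbols:
no two consecutive entries are equal and it avoids alternations of length `s + 2`. -/
def IsDS (s n : ℕ) (l : List (Fin n)) : Prop :=
  l.Chain' (· ≠ ·) ∧ AvoidsAlt l (s + 2)

/-- `lambdaDS s n` is the maximum length of an order-`s` Davenport–Schinzel
sequence over an alphabet of `n` symbols. -/
noncomputable def lambdaDS (s n : ℕ) : ℕ :=
  sSup { L | ∃ l : List (Fin n), IsDS s n l ∧ l.length = L }

open Classical in
/-- The number of maximal constant blocks of a list. -/
noncomputable def runs {α : Type*} (l : List α) : ℕ :=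
  (l.destutter (· ≠ ·)).length

open Classical in
/-- The number of maximal constant blocks of the restriction of `l` to the symbols `a`, `b`. -/
noncomputable def altRuns {α : Type*} (a b : α) (l : List α) : ℕ :=
  runs (l.filter fun x => x = a ∨ x = b)

section Runs

variable {α β : Type*}

lemma length_le_runs {l₁ l₂ : List α} (h : l₁.Sublist l₂) (h₁ : l₁.IsChain (· ≠ ·)) :
    l₁.length ≤ runs l₂ := by
  classical
  unfold runs
  convert h₁.length_le_length_destutter_ne h

lemma runs_eq_length {l : List α} (h : l.IsChain (· ≠ ·)) : runs l = l.length := by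
  classical
  unfold runs
  rw [List.destutter_of_isChain _ _ h]

lemma exists_chain_sublist (l : List α) :
    ∃ l' : List α, l'.Sublist l ∧ l'.IsChain (· ≠ ·) ∧ l'.length = runs l := by
  classical
  exact ⟨_, List.destutter_sublist _ l, List.isChain_destutter _ l, rfl⟩

lemma runs_le_length (l : List α) : runs l ≤ l.length := by
  obtain ⟨l', h, -, hl⟩ := exists_chain_sublist l
  rw [← hl]
  exact h.length_le

lemma runs_append_le (l₁ l₂ : List α) : runs (l₁ ++ l₂) ≤ runs l₁ + runs l₂ := by
  obtain ⟨l, h, hc, hl⟩ := exists_chain_sublist (l₁ ++ l₂)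
  obtain ⟨m₁, m₂, rfl, h₁, h₂⟩ := List.sublist_append_iff.1 h
  rw [List.isChain_append] at hc
  have := length_le_runs h₁ hc.1
  have := length_le_runs h₂ hc.2.1
  rw [List.length_append] at hl
  omega

lemma le_runs_append (l₁ l₂ : List α) :
    (runs l₁ - 1) + (runs l₂ - 1) ≤ runs (l₁ ++ l₂) - 1 := by
  obtain ⟨m₁, h₁, c₁, e₁⟩ := exists_chain_sublist l₁
  obtain ⟨m₂, h₂, c₂, e₂⟩ := exists_chain_sublist l₂
  rw [← e₁, ← e₂]
  rcases m₁.eq_nil_or_concat with rfl | ⟨m, x, rfl⟩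
  · have := length_le_runs (h₂.trans (List.sublist_append_right l₁ l₂)) c₂
    simp
    omega
  rcases m₂ with _ | ⟨y, m'⟩
  · have := length_le_runs (h₁.trans (List.sublist_append_left l₁ l₂)) c₁
    simp at this ⊢
    omega
  by_cases hxy : x = y
  · subst hxy
    have hc : ((m ++ [x]) ++ m').IsChain (· ≠ ·) := by
      rw [List.isChain_append]
      refine ⟨by simpa using c₁, c₂.tail, ?_⟩
      rw [List.isChain_cons] at c₂
      simpa using c₂.1
    have := length_le_runs (((by simpa using h₁ : (m ++ [x]).Sublist l₁)).append
      ((List.sublist_cons_self x m').trans h₂)) hc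
    simp at this ⊢
    omega
  · have hc : ((m ++ [x]) ++ (y :: m')).IsChain (· ≠ ·) := by
      rw [List.isChain_append]
      exact ⟨by simpa using c₁, c₂, by simpa using hxy⟩
    have := length_le_runs (((by simpa using h₁ : (m ++ [x]).Sublist l₁)).append h₂) hc
    simp at this ⊢
    omega

lemma runs_map {f : α → β} (hf : Function.Injective f) (l : List α) :
    runs (l.map f) = runs l := by
  classical
  unfold runs
  have := List.map_destutter_ne (l := l) hf
  rw [← List.length_map (f := f)]
  convert congrArg List.length this.symm using 2

lemma altRuns_comm (a b : α) (l : List α) : altRuns a b l = altRuns b a l := by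
  unfold altRuns
  congr 1
  refine List.filter_congr fun x _ => ?_
  rw [decide_eq_decide]
  exact or_comm

lemma altRuns_append_le (a b : α) (l₁ l₂ : List α) :
    altRuns a b (l₁ ++ l₂) ≤ altRuns a b l₁ + altRuns a b l₂ := by
  unfold altRuns
  rw [List.filter_append]
  exact runs_append_le _ _

lemma altRuns_flatMap_le {ι : Type*} (a b : α) (L : List ι) (f : ι → List α) :
    altRuns a b (L.flatMap f) ≤ (L.map fun i => altRuns a b (f i)).sum := by
  induction L with
  | nil => simp [altRuns, runs]
  | cons i L ih =>
    rw [List.flatMap_cons, List.map_cons, List.sum_cons]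
    exact (altRuns_append_le _ _ _ _).trans (Nat.add_le_add_left ih _)

lemma le_runs_flatMap {ι : Type*} (L : List ι) (f : ι → List α) :
    (L.map fun i => runs (f i) - 1).sum ≤ runs (L.flatMap f) - 1 := by
  induction L with
  | nil => simp
  | cons i L ih =>
    rw [List.flatMap_cons, List.map_cons, List.sum_cons]
    exact le_trans (by omega) (le_runs_append _ _)

lemma altRuns_le_length (a b : α) (l : List α) : altRuns a b l ≤ l.length :=
  (runs_le_length _).trans (List.length_filter_le _ _)

lemma altRuns_map {f : α → β} (hf : Function.Injective f) (a b : α) (l : List α) :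
    altRuns (f a) (f b) (l.map f) = altRuns a b l := by
  classical
  unfold altRuns
  rw [List.filter_map, runs_map hf]
  congr 2
  funext x
  simp [hf.eq_iff]

lemma altRuns_eq_zero {a b : α} {l : List α} (ha : a ∉ l) (hb : b ∉ l) :
    altRuns a b l = 0 := by
  classical
  have : l.filter (fun x => x = a ∨ x = b) = [] := by
    rw [List.filter_eq_nil_iff]
    rintro x hx h
    simp only [decide_eq_true_eq] at h
    rcases h with rfl | rfl
    exacts [ha hx, hb hx]
  unfold altRuns
  have h2 := runs_le_length ([] : List α)
  convert Nat.le_zero.1 h2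

lemma altRuns_le_one {a b : α} {l : List α} (ha : a ∉ l) : altRuns a b l ≤ 1 := by
  classical
  unfold altRuns
  obtain ⟨m, h, c, e⟩ := exists_chain_sublist (l.filter fun x => x = a ∨ x = b)
  have hm : ∀ x ∈ m, x = b := by
    intro x hx
    have := h.subset hx
    simp only [List.mem_filter, decide_eq_true_eq] at this
    rcases this.2 with rfl | h
    exacts [(ha this.1).elim, h]
  have : m.length ≤ 1 := by
    match m, c, hm with
    | [], _, _ => simp
    | [_], _, _ => simp
    | x :: y :: _, c, hm =>
      rw [List.isChain_cons_cons] at c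
      exact (c.1 ((hm x (by simp)).trans (hm y (by simp)).symm)).elim
  convert this using 1
  rw [e]

open Classical in
lemma altRuns_le_of_not_both {a b : α} {l : List α} (h : ¬ (a ∈ l ∧ b ∈ l)) :
    altRuns a b l ≤ (if a ∈ l then 1 else 0) + (if b ∈ l then 1 else 0) := by
  by_cases ha : a ∈ l
  · have hb : b ∉ l := fun hb => h ⟨ha, hb⟩
    rw [altRuns_comm]
    simpa [ha, hb] using altRuns_le_one hb
  · by_cases hb : b ∈ l
    · simpa [ha, hb] using altRuns_le_one ha
    · simp [altRuns_eq_zero ha hb]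

lemma length_altSeq (a b : α) (k : ℕ) : (altSeq a b k).length = k := by
  induction k generalizing a b with
  | zero => rfl
  | succ k ih => simp [altSeq, ih]

lemma mem_altSeq {a b x : α} {k : ℕ} (h : x ∈ altSeq a b k) : x = a ∨ x = b := by
  induction k generalizing a b with
  | zero => simp [altSeq] at h
  | succ k ih =>
    rw [altSeq, List.mem_cons] at h
    rcases h with h | h
    · exact Or.inl h
    · exact (ih h).symm

lemma isChain_altSeq {a b : α} (hab : a ≠ b) (k : ℕ) : (altSeq a b k).IsChain (· ≠ ·) := by
  induction k generalizing a b with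
  | zero => exact .nil
  | succ k ih =>
    rw [altSeq, List.isChain_cons]
    refine ⟨?_, ih hab.symm⟩
    cases k with
    | zero => simp [altSeq]
    | succ k => simpa [altSeq] using hab

lemma altSeq_sublist (a b : α) {k m : ℕ} (h : k ≤ m) :
    (altSeq a b k).Sublist (altSeq a b m) := by
  induction k generalizing a b m with
  | zero => simp [altSeq]
  | succ k ih =>
    obtain ⟨m, rfl⟩ : ∃ m', m = m' + 1 := ⟨m - 1, by omega⟩
    exact (ih b a (by omega)).cons_cons a

lemma le_altRuns {a b : α} {l : List α} {k : ℕ} (hab : a ≠ b)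
    (h : (altSeq a b k).Sublist l) : k ≤ altRuns a b l := by
  classical
  have := length_le_runs (h.filter fun x => x = a ∨ x = b) (by
    rw [List.filter_eq_self.2 fun x hx => decide_eq_true (mem_altSeq hx)]
    exact isChain_altSeq hab k)
  rw [List.filter_eq_self.2 fun x hx => decide_eq_true (mem_altSeq hx), length_altSeq] at this
  unfold altRuns
  convert this

end Runs

section Bounded

variable {α : Type*}

/-- The consecutive disjoint pairs of entries of a list. -/
def adjacentPairs : List α → List (α × α)
  | x :: y :: l => (x, y) :: adjacentPairs l
  | _ => []

lemma length_le_adjacentPairs (l : List α) : l.length ≤ 2 * (adjacentPairs l).length + 1 := by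
  induction l using adjacentPairs.induct with
  | case1 x y l ih => simp [adjacentPairs]; omega
  | case2 l h =>
    match l, h with
    | [], _ => simp
    | [_], _ => simp
    | x :: y :: l, h => exact (h x y l rfl).elim

lemma ne_of_mem_adjacentPairs {l : List α} (h : l.IsChain (· ≠ ·)) {p : α × α}
    (hp : p ∈ adjacentPairs l) : p.1 ≠ p.2 := by
  induction l using adjacentPairs.induct with
  | case1 x y l ih =>
    rw [List.isChain_cons_cons] at h
    rw [adjacentPairs, List.mem_cons] at hp
    rcases hp with rfl | hp
    · exact h.1
    · exact ih h.2.tail hp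
  | case2 l hne =>
    match l, hp with
    | [], hp => simp [adjacentPairs] at hp
    | [_], hp => simp [adjacentPairs] at hp
    | x :: y :: l, _ => exact (hne x y l rfl).elim

lemma altSeq_count_adjacentPairs_sublist [DecidableEq α] (a b : α) (l : List α) :
    (altSeq a b (2 * (adjacentPairs l).count (a, b))).Sublist l := by
  induction l using adjacentPairs.induct with
  | case1 x y l ih =>
    rw [adjacentPairs, List.count_cons]
    split_ifs with h
    · obtain ⟨rfl, rfl⟩ : x = a ∧ y = b := by simpa using h
      rw [mul_add]
      exact (ih.cons_cons y).cons_cons x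
    · exact (ih.cons y).cons x
  | case2 l h =>
    match l, h with
    | [], _ => simp [adjacentPairs, altSeq]
    | [_], _ => simp [adjacentPairs, altSeq]
    | x :: y :: l, h => exact (h x y l rfl).elim

lemma IsDS.length_le {s n : ℕ} {l : List (Fin n)} (h : IsDS s n l) :
    l.length ≤ 2 * (n * n * (s + 2)) + 1 := by
  refine (length_le_adjacentPairs l).trans ?_
  have hsum : (adjacentPairs l).length =
      ∑ p : Fin n × Fin n, (adjacentPairs l).count p := by
    have := Multiset.sum_count_eq_card (s := Finset.univ) 
      (m := (↑(adjacentPairs l) : Multiset (Fin n × Fin n)))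
      (fun _ _ => Finset.mem_univ _)
    simp only [Multiset.coe_card, Multiset.coe_count] at this
    rw [← this]
    congr! 3
  have hcount : ∀ p ∈ (Finset.univ : Finset (Fin n × Fin n)),
      (adjacentPairs l).count p ≤ s + 2 := by
    rintro ⟨a, b⟩ -
    by_cases hab : a = b
    · rw [List.count_eq_zero_of_not_mem fun hp => ne_of_mem_adjacentPairs h.1 hp hab]
      omega
    · by_contra hlt
      exact h.2 a b hab ((altSeq_sublist a b (by omega)).trans
        (altSeq_count_adjacentPairs_sublist a b l))
  have := Finset.sum_le_sum hcount
  rw [← hsum] at this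
  simp at this
  omega

lemma IsDS.length_le_lambdaDS {s n : ℕ} {l : List (Fin n)} (h : IsDS s n l) :
    l.length ≤ lambdaDS s n := by
  refine le_csSup ⟨2 * (n * n * (s + 2)) + 1, ?_⟩ ⟨l, h, rfl⟩
  rintro _ ⟨l', h', rfl⟩
  exact h'.length_le

end Bounded

section Transfer

variable {α : Type*}

lemma map_altSeq {β : Type*} (f : α → β) (a b : α) (k : ℕ) :
    (altSeq a b k).map f = altSeq (f a) (f b) k := by
  induction k generalizing a b with
  | zero => rfl
  | succ k ih => simp [altSeq, ih]

lemma runs_le_lambdaDS [DecidableEq α] {l : List α} {s n : ℕ} (hn : 0 < n) (hcard : l.toFinset.card ≤ n)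
    (h : ∀ a ∈ l, ∀ b ∈ l, a ≠ b → altRuns a b l ≤ s + 1) : runs l ≤ lambdaDS s n := by
  obtain ⟨e⟩ : Nonempty (l.toFinset ↪ Fin n) :=
    Function.Embedding.nonempty_of_card_le (by rwa [Fintype.card_coe, Fintype.card_fin])
  let f : α → Fin n := fun p => if hp : p ∈ l.toFinset then e ⟨p, hp⟩ else ⟨0, hn⟩
  have hf : ∀ x ∈ l, ∀ y ∈ l, f x = f y → x = y := by
    intro x hx y hy hxy
    simpa [f, hx, hy] using hxy
  obtain ⟨d, hd, hc, hlen⟩ := exists_chain_sublist l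
  have hDS : IsDS s n (d.map f) := by
    refine ⟨?_, ?_⟩
    · change (d.map f).IsChain (· ≠ ·)
      rw [List.isChain_map]
      refine List.IsChain.imp_of_mem_imp (fun x y hx hy hxy h => ?_) hc
      exact hxy (hf x (hd.subset hx) y (hd.subset hy) h)
    · intro a b hab hs
      obtain ⟨x, hx, rfl⟩ : ∃ x ∈ d, f x = a := by
        simpa using hs.subset (by simp [altSeq] : a ∈ altSeq a b (s + 2))
      obtain ⟨y, hy, rfl⟩ : ∃ y ∈ d, f y = b := by
        simpa using hs.subset (by simp [altSeq] : b ∈ altSeq (f x) b (s + 2))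
      have hx' := hd.subset hx
      have hy' := hd.subset hy
      have : Nonempty α := ⟨x⟩
      have hinj : Set.InjOn f {z | z ∈ l} := fun u hu v hv => hf u hu v hv
      have hleft := hinj.leftInvOn_invFunOn
      have h2 := hs.map (Function.invFunOn f {z | z ∈ l})
      rw [map_altSeq, hleft hx', hleft hy', List.map_map,
        (List.map_congr_left fun z hz => hleft (hd.subset hz) :
          d.map (Function.invFunOn f {z | z ∈ l} ∘ f) = d.map id), List.map_id] at h2
      have hxy : x ≠ y := fun h => hab (congrArg f h)
      have h3 := le_altRuns hxy (h2.trans hd)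
      have h4 := h x hx' y hy' hxy
      omega
  have := hDS.length_le_lambdaDS
  rwa [List.length_map, hlen] at this

end Transfer

section PairwiseAlternations

variable {α : Type*}

open Classical in
lemma altRuns_altSeq_le {c d : α} (p : α × α) (m : ℕ) (hp : p.1 ≠ p.2) (hcd : c ≠ d) :
    altRuns c d (altSeq p.1 p.2 m) ≤ (if p = (c, d) then m else 0) +
      (if p = (d, c) then m else 0) + ((if p.1 = c then 1 else 0) + (if p.2 = c then 1 else 0)) +
      ((if p.1 = d then 1 else 0) + (if p.2 = d then 1 else 0)) := by
  obtain ⟨a, b⟩ := p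
  by_cases h : c ∈ altSeq a b m ∧ d ∈ altSeq a b m
  · have h0 := altRuns_le_length c d (altSeq a b m)
    rw [length_altSeq] at h0
    rcases mem_altSeq h.1 with rfl | rfl <;> rcases mem_altSeq h.2 with rfl | rfl
    · exact (hcd rfl).elim
    · simp; omega
    · simp; omega
    · exact (hcd rfl).elim
  · have h0 := altRuns_le_of_not_both h
    have hc : (if c ∈ altSeq a b m then 1 else 0) ≤
        (if a = c then 1 else 0) + (if b = c then 1 else 0) := by
      split_ifs with h1 <;> simp
      have := mem_altSeq h1
      grind
    have hd : (if d ∈ altSeq a b m then 1 else 0) ≤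
        (if a = d then 1 else 0) + (if b = d then 1 else 0) := by
      split_ifs with h1 <;> simp
      have := mem_altSeq h1
      grind
    dsimp only
    omega

open Classical in
lemma sum_offDiag_incidence_le (A : Finset α) (c : α) :
    ∑ p ∈ A.offDiag, ((if p.1 = c then 1 else 0) + (if p.2 = c then 1 else 0)) ≤
      2 * A.card := by
  have hsub : A.offDiag ⊆ A ×ˢ A := by
    intro p hp
    rw [Finset.mem_offDiag] at hp
    exact Finset.mem_product.2 ⟨hp.1, hp.2.1⟩
  refine (Finset.sum_le_sum_of_subset hsub).trans ?_
  rw [Finset.sum_add_distrib, Finset.sum_product, Finset.sum_product_right, two_mul]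
  have h (B : Finset α) : ∑ x ∈ B, (if x = c then 1 else 0) ≤ 1 := by
    rw [Finset.sum_ite_eq']
    split_ifs <;> simp
  refine add_le_add ?_ ?_
  · rw [Finset.sum_comm]
    simpa using Finset.sum_le_card_nsmul A _ 1 fun y _ => h A
  · rw [Finset.sum_comm]
    simpa using Finset.sum_le_card_nsmul A _ 1 fun y _ => h A

lemma exists_list_alternating_pairs (A : Finset α) (m : ℕ) :
    ∃ l : List α, (∀ x ∈ l, x ∈ A) ∧
      (A.card * A.card - A.card) * (2 * m - 1) ≤ runs l - 1 ∧
      ∀ c d : α, c ≠ d → altRuns c d l ≤ 4 * m + 4 * A.card := by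
  classical
  refine ⟨A.offDiag.toList.flatMap fun p => altSeq p.1 p.2 (2 * m), ?_, ?_, ?_⟩
  · intro x hx
    obtain ⟨p, hp, hx⟩ := List.mem_flatMap.1 hx
    rw [Finset.mem_toList, Finset.mem_offDiag] at hp
    rcases mem_altSeq hx with rfl | rfl
    exacts [hp.1, hp.2.1]
  · refine le_trans (le_of_eq ?_) (le_runs_flatMap _ _)
    rw [Finset.sum_map_toList, ← Finset.offDiag_card, ← smul_eq_mul, ← Finset.sum_const]
    refine Finset.sum_congr rfl fun p hp => ?_
    rw [runs_eq_length (isChain_altSeq (Finset.mem_offDiag.1 hp).2.2 _), length_altSeq]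
  · intro c d hcd
    refine (altRuns_flatMap_le _ _ _ _).trans ?_
    rw [Finset.sum_map_toList]
    refine (Finset.sum_le_sum fun p hp =>
      altRuns_altSeq_le p (2 * m) (Finset.mem_offDiag.1 hp).2.2 hcd).trans ?_
    rw [Finset.sum_add_distrib, Finset.sum_add_distrib, Finset.sum_add_distrib]
    have h1 := sum_offDiag_incidence_le A c
    have h2 := sum_offDiag_incidence_le A d
    have h3 (x : α × α) : ∑ p ∈ A.offDiag, (if p = x then 2 * m else 0) ≤ 2 * m := by
      rw [Finset.sum_ite_eq']
      split_ifs <;> simp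
    have h4 := h3 (c, d)
    have h5 := h3 (d, c)
    omega

end PairwiseAlternations

section PolynomialBlocks

open Polynomial

variable {F : Type*} [Field F]

/-- The polynomials taking the value `y` at `x` are the values of this map. -/
noncomputable def interpolate (x y : F) (r : F[X]) : F[X] := C y + (X - C x) * r

lemma eval_interpolate (x y : F) (r : F[X]) : (interpolate x y r).eval x = y := by
  simp [interpolate]

lemma interpolate_injective (x y : F) : Function.Injective (interpolate x y) := by
  intro r₁ r₂ h
  exact mul_left_cancel₀ (X_sub_C_ne_zero x) (add_left_cancel h)

lemma natDegree_interpolate_le {x y : F} {r : F[X]} {j : ℕ} (h : r.natDegree ≤ j) :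
    (interpolate x y r).natDegree ≤ j + 1 := by
  refine (natDegree_add_le _ _).trans (max_le (by simp) (natDegree_mul_le.trans ?_))
  rw [natDegree_X_sub_C]
  omega

lemma coeff_interpolate {x y : F} {r : F[X]} {j : ℕ} (h : r.natDegree ≤ j) :
    (interpolate x y r).coeff (j + 1) = r.coeff j := by
  rw [interpolate, coeff_add, coeff_C_succ, sub_mul, coeff_sub, coeff_X_mul, coeff_C_mul,
    coeff_eq_zero_of_natDegree_lt (n := j + 1) (by omega)]
  simp

open Classical in
lemma card_eval_eq_le [Fintype F] {a b : F[X]} {j : ℕ} (hab : a ≠ b)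
    (ha : a.natDegree ≤ j) (hb : b.natDegree ≤ j) :
    (Finset.univ.filter fun x : F => a.eval x = b.eval x).card ≤ j := by
  have hne : a - b ≠ 0 := sub_ne_zero.2 hab
  have hsub : (Finset.univ.filter fun x : F => a.eval x = b.eval x) ⊆
      (a - b).roots.toFinset := by
    intro x hx
    rw [Finset.mem_filter] at hx
    rw [Multiset.mem_toFinset, mem_roots hne, IsRoot.def, eval_sub, hx.2, sub_self]
  refine (Finset.card_le_card hsub).trans ((Multiset.toFinset_card_le _).trans ?_)
  exact (card_roots' _).trans ((natDegree_sub_le _ _).trans (max_le ha hb))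

open Classical in
lemma altRuns_map_interpolate_le {l : List F[X]} {k : ℕ}
    (hk : ∀ a ∈ l, ∀ b ∈ l, a ≠ b → altRuns a b l ≤ k) {a b : F[X]} (hab : a ≠ b) (x y : F) :
    altRuns a b (l.map (interpolate x y)) ≤
      (if a.eval x = y ∧ b.eval x = y then k else 0) +
      ((if a.eval x = y then 1 else 0) + (if b.eval x = y then 1 else 0)) := by
  have heval : ∀ p ∈ l.map (interpolate x y), p.eval x = y := by
    intro p hp
    obtain ⟨r, -, rfl⟩ := List.mem_map.1 hp
    exact eval_interpolate x y r
  by_cases h : a ∈ l.map (interpolate x y) ∧ b ∈ l.map (interpolate x y)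
  · rw [if_pos ⟨heval a h.1, heval b h.2⟩]
    obtain ⟨r, hr, rfl⟩ := List.mem_map.1 h.1
    obtain ⟨u, hu, rfl⟩ := List.mem_map.1 h.2
    rw [altRuns_map (interpolate_injective x y)]
    exact (hk r hr u hu fun h => hab (congrArg _ h)).trans (Nat.le_add_right _ _)
  · refine (altRuns_le_of_not_both h).trans (le_add_left (add_le_add ?_ ?_))
    · split_ifs with h1 h2 <;> simp
      exact h2 (heval a h1)
    · split_ifs with h1 h2 <;> simp
      exact h2 (heval b h1)

lemma exists_list_succ [Fintype F] (A : Finset F) {j M k : ℕ} {l : List F[X]}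
    (hl : ∀ p ∈ l, p.natDegree ≤ j ∧ p.coeff j ∈ A) (hM : M ≤ runs l - 1)
    (hk : ∀ a ∈ l, ∀ b ∈ l, a ≠ b → altRuns a b l ≤ k) :
    ∃ l' : List F[X], (∀ p ∈ l', p.natDegree ≤ j + 1 ∧ p.coeff (j + 1) ∈ A) ∧
      Fintype.card F ^ 2 * M ≤ runs l' - 1 ∧
      ∀ a ∈ l', ∀ b ∈ l', a ≠ b →
        altRuns a b l' ≤ (j + 1) * k + 2 * Fintype.card F := by
  classical
  let l' := (Finset.univ : Finset (F × F)).toList.flatMap fun z => l.map (interpolate z.1 z.2)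
  have hl' : ∀ p ∈ l', p.natDegree ≤ j + 1 ∧ p.coeff (j + 1) ∈ A := by
    intro p hp
    obtain ⟨z, -, hp⟩ := List.mem_flatMap.1 hp
    obtain ⟨r, hr, rfl⟩ := List.mem_map.1 hp
    rw [coeff_interpolate (hl r hr).1]
    exact ⟨natDegree_interpolate_le (hl r hr).1, (hl r hr).2⟩
  refine ⟨l', hl', ?_, ?_⟩
  · refine le_trans ?_ (le_runs_flatMap _ _)
    rw [Finset.sum_map_toList]
    simp only [runs_map (interpolate_injective _ _), Finset.sum_const, Finset.card_univ,
      Fintype.card_prod, smul_eq_mul, ← pow_two]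
    exact Nat.mul_le_mul_left _ hM
  · intro a ha b hb hab
    refine (altRuns_flatMap_le _ _ _ _).trans ?_
    rw [Finset.sum_map_toList]
    refine (Finset.sum_le_sum fun z _ =>
      altRuns_map_interpolate_le hk hab z.1 z.2).trans ?_
    rw [Finset.sum_add_distrib]
    refine add_le_add ?_ (le_of_eq ?_)
    · rw [Fintype.sum_prod_type]
      have h (x : F) : ∑ y : F, (if a.eval x = y ∧ b.eval x = y then k else 0) =
          if a.eval x = b.eval x then k else 0 := by
        simp only [ite_and, Finset.sum_ite_eq, Finset.mem_univ, if_true]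
        simp [eq_comm]
      simp only [h]
      rw [← Finset.sum_filter, Finset.sum_const, smul_eq_mul]
      exact Nat.mul_le_mul_right _ (card_eval_eq_le hab (hl' a ha).1 (hl' b hb).1)
    · rw [Fintype.sum_prod_type]
      simp [Finset.sum_add_distrib, mul_comm]

/-- The number of alternations allowed after `j` recursive steps over a field with `q`
elements, starting from `k`. -/
def alternationBound (q k : ℕ) : ℕ → ℕ
  | 0 => k
  | j + 1 => (j + 1) * alternationBound q k j + 2 * q

lemma alternationBound_succ_le (q k j : ℕ) :
    alternationBound q k (j + 1) + 2 * q ≤ (j + 1).factorial * (k + 4 * q) := by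
  induction j with
  | zero => simp [alternationBound]; omega
  | succ j ih =>
    rw [alternationBound, Nat.factorial_succ, mul_assoc]
    refine le_trans ?_ (Nat.mul_le_mul_left _ ih)
    rw [mul_add]
    nlinarith [Nat.zero_le (j * q)]

lemma alternationBound_le (q k j : ℕ) :
    alternationBound q k j ≤ j.factorial * (k + 4 * q) := by
  cases j with
  | zero => simp [alternationBound]
  | succ j => exact le_trans (Nat.le_add_right _ _) (alternationBound_succ_le q k j)

lemma exists_list_polynomial [Fintype F] (A : Finset F) (m j : ℕ) :
    ∃ l : List F[X], (∀ p ∈ l, p.natDegree ≤ j ∧ p.coeff j ∈ A) ∧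
      (Fintype.card F ^ j) ^ 2 * ((A.card * A.card - A.card) * (2 * m - 1)) ≤ runs l - 1 ∧
      ∀ a ∈ l, ∀ b ∈ l, a ≠ b →
        altRuns a b l ≤ alternationBound (Fintype.card F) (4 * m + 4 * A.card) j := by
  induction j with
  | zero =>
    obtain ⟨l, h₁, h₂, h₃⟩ := exists_list_alternating_pairs A m
    refine ⟨l.map C, ?_, ?_, ?_⟩
    · intro p hp
      obtain ⟨r, hr, rfl⟩ := List.mem_map.1 hp
      simpa using h₁ r hr
    · rw [runs_map C_injective]
      simpa using h₂
    · intro a ha b hb hab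
      obtain ⟨r, hr, rfl⟩ := List.mem_map.1 ha
      obtain ⟨u, hu, rfl⟩ := List.mem_map.1 hb
      rw [altRuns_map C_injective]
      exact h₃ r u fun h => hab (congrArg _ h)
  | succ j ih =>
    obtain ⟨l, h₁, h₂, h₃⟩ := ih
    obtain ⟨l', h₁', h₂', h₃'⟩ := exists_list_succ A h₁ h₂ h₃
    refine ⟨l', h₁', le_trans (le_of_eq ?_) h₂', h₃'⟩
    ring

lemma card_toFinset_le [Fintype F] [DecidableEq F[X]] (A : Finset F) {j : ℕ} {l : List F[X]}
    (hl : ∀ p ∈ l, p.natDegree ≤ j ∧ p.coeff j ∈ A) :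
    l.toFinset.card ≤ Fintype.card F ^ j * A.card := by
  have := Finset.card_le_card_of_injOn (s := l.toFinset)
    (t := (Finset.univ : Finset (Fin j → F)) ×ˢ A)
    (fun p => (fun i => p.coeff i, p.coeff j)) ?_ ?_
  · simpa using this
  · intro p hp
    simpa using (hl p (by simpa using hp)).2
  · intro p hp r hr h
    simp only [Prod.mk.injEq] at h
    have hp' := (hl p (by simpa using hp)).1
    have hr' := (hl r (by simpa using hr)).1
    ext i
    rcases lt_trichotomy i j with hi | rfl | hi
    · exact congrFun h.1 ⟨i, hi⟩
    · exact h.2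
    · rw [coeff_eq_zero_of_natDegree_lt (by omega), coeff_eq_zero_of_natDegree_lt (by omega)]

end PolynomialBlocks

lemma le_lambdaDS_of_prime {q a j m s n : ℕ} (hq : q.Prime) (haq : a ≤ q) (hn : 0 < n)
    (han : q ^ j * a ≤ n) (hs : j.factorial * (4 * m + 8 * q) ≤ s) :
    (q ^ j) ^ 2 * ((a * a - a) * (2 * m - 1)) ≤ lambdaDS s n := by
  classical
  have := Fact.mk hq
  obtain ⟨A, -, rfl⟩ := Finset.exists_subset_card_eq
    (s := (Finset.univ : Finset (ZMod q))) (n := a) (by simpa using haq)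
  obtain ⟨l, h₁, h₂, h₃⟩ := exists_list_polynomial A m j
  rw [ZMod.card] at h₂ h₃
  refine h₂.trans ((Nat.sub_le _ _).trans (runs_le_lambdaDS hn ?_ ?_))
  · have := card_toFinset_le A h₁
    rw [ZMod.card] at this
    exact this.trans han
  · intro x hx y hy hxy
    refine (h₃ x hx y hy hxy).trans ((alternationBound_le _ _ _).trans ?_)
    have : j.factorial * (4 * m + 4 * A.card + 4 * q) ≤ j.factorial * (4 * m + 8 * q) :=
      Nat.mul_le_mul_left _ (by omega)
    omega

lemma exists_prime_between_root {t n : ℕ} (ht : 1 ≤ t) (hn : 2 ≤ n) :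
    ∃ q : ℕ, q.Prime ∧ n ≤ q ^ t ∧ (q : ℝ) ≤ 4 * (n : ℝ) ^ ((1 : ℝ) / t) := by
  have h1 : (1 : ℝ) ≤ (n : ℝ) ^ ((1 : ℝ) / t) :=
    Real.one_le_rpow (by exact_mod_cast (by omega : 1 ≤ n)) (by positivity)
  set r : ℝ := (n : ℝ) ^ ((1 : ℝ) / t) with hr
  have hpos : 0 < ⌈r⌉₊ := Nat.ceil_pos.2 (by linarith)
  obtain ⟨q, hq, hlt, hle⟩ := Nat.exists_prime_lt_and_le_two_mul ⌈r⌉₊ hpos.ne'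
  have hceil := Nat.ceil_lt_add_one (by linarith : 0 ≤ r)
  have hle' : (q : ℝ) ≤ 2 * ⌈r⌉₊ := by exact_mod_cast hle
  refine ⟨q, hq, ?_, by linarith⟩
  have hrq : r ≤ q := (Nat.le_ceil r).trans (by exact_mod_cast hlt.le)
  have hrt : r ^ t = n := by
    rw [hr, one_div]
    exact Real.rpow_inv_natCast_pow (by positivity) (by omega)
  have := pow_le_pow_left₀ (by linarith : 0 ≤ r) hrq t
  rw [hrt] at this
  exact_mod_cast this

lemma exists_mul_pow_near {q t n : ℕ} (hq : 2 ≤ q) (hn : 2 ≤ n) (hnq : n ≤ q ^ t) :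
    ∃ j a : ℕ, j ≤ t - 1 ∧ 2 ≤ a ∧ a ≤ q ∧ q ^ j * a ≤ n ∧ n ≤ 2 * (q ^ j * a) := by
  set j := Nat.log q (n / 2) with hj
  have h1 : q ^ j ≤ n / 2 := Nat.pow_log_le_self q (by omega)
  have h2 : n / 2 < q ^ (j + 1) := Nat.lt_pow_succ_log_self (by omega) _
  have hjpos : 0 < q ^ j := by positivity
  have hjt : j < t := (Nat.pow_lt_pow_iff_right (by omega : 1 < q)).1 (by omega)
  have h3 : 2 ≤ n / q ^ j := (Nat.le_div_iff_mul_le hjpos).2 (by omega)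
  refine ⟨j, min q (n / q ^ j), by omega, le_min hq h3, min_le_left _ _, ?_, ?_⟩
  · exact (Nat.mul_le_mul_left _ (min_le_right _ _)).trans (Nat.mul_div_le _ _)
  · rcases le_total q (n / q ^ j) with h | h
    · rw [min_eq_left h, ← pow_succ]
      omega
    · rw [min_eq_right h]
      have := Nat.lt_mul_div_succ n hjpos
      nlinarith

theorem stmt9 :
    ∃ c C : ℝ, 0 < c ∧ 0 < C ∧ ∀ t n s : ℕ, 1 ≤ t → 2 ≤ n → 1 ≤ s →
      C * (n : ℝ) ^ ((1 : ℝ) / t) * (t - 1).factorial ≤ (s : ℝ) →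
      c * (n : ℝ) ^ 2 * s / (t - 1).factorial ≤ (lambdaDS s n : ℝ) := by
  refine ⟨1 / 128, 64, by norm_num, by norm_num, ?_⟩
  intro t n s ht hn _ hs
  obtain ⟨q, hq, hnq, hqr⟩ := exists_prime_between_root ht hn
  obtain ⟨j, a, hjt, ha2, haq, han, hna⟩ := exists_mul_pow_near hq.two_le hn hnq
  set f := (t - 1).factorial with hf
  have hfpos : 0 < f := Nat.factorial_pos _
  have hfR : (0 : ℝ) < f := by exact_mod_cast hfpos
  have hjf : j.factorial ≤ f := Nat.factorial_le hjt
  have hqs : 16 * q * f ≤ s := by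
    have : (16 * q * f : ℝ) ≤ s := by nlinarith
    exact_mod_cast this
  set m := s / (8 * f) with hm
  have hm1 : m * (8 * f) ≤ s := Nat.div_mul_le_self _ _
  have hm2 : s < 8 * f * (m + 1) := Nat.lt_mul_div_succ s (by omega)
  have hmpos : 1 ≤ m := (Nat.le_div_iff_mul_le (by omega)).2 (by nlinarith [hq.two_le])
  have key := le_lambdaDS_of_prime (m := m) (s := s) hq haq (by omega) han
    ((Nat.mul_le_mul_right _ hjf).trans (by nlinarith))
  have h1 : a * a ≤ 2 * (a * a - a) := by
    have : a * 2 ≤ a * a := Nat.mul_le_mul_left _ ha2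
    omega
  have h2 : s ≤ 16 * f * (2 * m - 1) := by
    have : 8 * f * (m + 1) ≤ 8 * f * (2 * (2 * m - 1)) := Nat.mul_le_mul_left _ (by omega)
    nlinarith
  have h3 : n ^ 2 * s ≤ 128 * f * lambdaDS s n := by
    calc n ^ 2 * s ≤ (2 * (q ^ j * a)) ^ 2 * (16 * f * (2 * m - 1)) :=
          Nat.mul_le_mul (Nat.pow_le_pow_left hna 2) h2
      _ = 64 * f * ((q ^ j) ^ 2 * ((a * a) * (2 * m - 1))) := by ring
      _ ≤ 64 * f * ((q ^ j) ^ 2 * ((2 * (a * a - a)) * (2 * m - 1))) := by gcongr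
      _ = 128 * f * ((q ^ j) ^ 2 * ((a * a - a) * (2 * m - 1))) := by ring
      _ ≤ 128 * f * lambdaDS s n := by gcongr
  have h4 : (n : ℝ) ^ 2 * s ≤ 128 * f * lambdaDS s n := by exact_mod_cast h3
  rw [div_le_iff₀ hfR]
  nlinarith
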